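/- arXiv:2602.06853 — 3 statements merged into one kernel-verified Lean document; each statement's English description precedes it below -/
import Mathlib

section
/- Let (X,d,m) be a metric measure space, x0 ∈ X with m({x0}) = 0, let N > 0 and c > 0 be real numbers, and let k ≥ 1 be an integer. Assume that ∫_{B_ρ(x0)} d(x0,x)^{2k} dm(x) = c ρ^{N+2k} for all ρ > 0. Then m(B_ρ(x0)) = c (N+2k)/N · ρ^N for all ρ > 0; in particular (X,d,m) is an N-volume cone with vertex x0. -/
open MeasureTheory Metric
open scoped ENNReal

/-- The integral of `r ^ (p - 1)` over `(0, a)` is `a ^ p / p`. -/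
lemma lintegral_Ioo_rpow_sub_one {p a : ℝ} (hp : 0 < p) (ha : 0 ≤ a) :
    ∫⁻ r in Set.Ioo 0 a, ENNReal.ofReal (r ^ (p - 1)) = ENNReal.ofReal (a ^ p / p) := by
  have hint : IntervalIntegrable (fun r : ℝ => r ^ (p - 1)) volume 0 a :=
    intervalIntegral.intervalIntegrable_rpow' (by linarith)
  have hon : IntegrableOn (fun r : ℝ => r ^ (p - 1)) (Set.Ioo 0 a) :=
    ((intervalIntegrable_iff_integrableOn_Ioc_of_le ha).1 hint).mono_set Set.Ioo_subset_Ioc_self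
  rw [← ofReal_integral_eq_lintegral_ofReal hon]
  · rw [← integral_Ioc_eq_integral_Ioo, ← intervalIntegral.integral_of_le ha,
      integral_rpow (Or.inl (by linarith)), sub_add_cancel, Real.zero_rpow hp.ne', sub_zero]
  · filter_upwards [ae_restrict_mem measurableSet_Ioo] with r hr
    exact Real.rpow_nonneg hr.1.le _

/-- The pushforward of `d(x0, ·) ^ n • m` under the distance from `x0`. -/
noncomputable def weightedRadialMeasure {X : Type*} [MetricSpace X] [MeasurableSpace X]
    (m : Measure X) (x0 : X) (n : ℕ) : Measure ℝ :=
  (m.withDensity fun x => ENNReal.ofReal (dist x0 x ^ n)).map (dist x0)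

lemma weightedRadialMeasure_Iio {X : Type*} [MetricSpace X] [MeasurableSpace X]
    [BorelSpace X] (m : Measure X) (x0 : X) (n : ℕ) (a : ℝ) :
    weightedRadialMeasure m x0 n (Set.Iio a) =
      ∫⁻ x in ball x0 a, ENNReal.ofReal (dist x0 x ^ n) ∂m := by
  have hd : Measurable (dist x0) := (continuous_const.dist continuous_id).measurable
  have hpre : dist x0 ⁻¹' Set.Iio a = ball x0 a := by
    ext x; simp [dist_comm]
  rw [weightedRadialMeasure, Measure.map_apply hd measurableSet_Iio, hpre,
    withDensity_apply _ measurableSet_ball]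

/-- Undoing the weight recovers the measure of balls, when the center is negligible. -/
lemma setLIntegral_weightedRadialMeasure_inv {X : Type*} [MetricSpace X]
    [MeasurableSpace X] [BorelSpace X] (m : Measure X) (x0 : X) (hx0 : m {x0} = 0)
    (n : ℕ) (a : ℝ) :
    ∫⁻ r in Set.Iio a, ENNReal.ofReal ((r ^ n)⁻¹) ∂(weightedRadialMeasure m x0 n) =
      m (ball x0 a) := by
  have hd : Measurable (dist x0) := (continuous_const.dist continuous_id).measurable
  have hpre : dist x0 ⁻¹' Set.Iio a = ball x0 a := by
    ext x; simp [dist_comm]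
  have hinv : Measurable fun r : ℝ => ENNReal.ofReal ((r ^ n)⁻¹) := by fun_prop
  have hinvd : Measurable fun x : X => ENNReal.ofReal ((dist x0 x ^ n)⁻¹) := hinv.comp hd
  rw [weightedRadialMeasure, setLIntegral_map measurableSet_Iio hinv hd, hpre,
    setLIntegral_withDensity_eq_setLIntegral_mul _ (by fun_prop) hinvd
      measurableSet_ball, ← setLIntegral_one]
  refine lintegral_congr_ae (ae_restrict_of_ae ?_)
  have hne : ∀ᵐ x ∂m, x ≠ x0 := by
    rw [ae_iff]; simpa using hx0
  filter_upwards [hne] with x hx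
  have hpos : 0 < dist x0 x ^ n := pow_pos (dist_pos.2 hx.symm) n
  simp only [Pi.mul_apply]
  rw [← ENNReal.ofReal_mul hpos.le, mul_inv_cancel₀ hpos.ne', ENNReal.ofReal_one]

lemma measure_ball_of_setIntegral_dist_pow {X : Type*} [MetricSpace X]
    [MeasurableSpace X] [BorelSpace X] (m : Measure X) (x0 : X) (hx0 : m {x0} = 0)
    {N c : ℝ} (hN : 0 < N) (hc : 0 < c) (n : ℕ)
    (hvol : ∀ ρ : ℝ, 0 < ρ → (∫ x in ball x0 ρ, dist x0 x ^ n ∂m) = c * ρ ^ (N + n))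
    {ρ : ℝ} (hρ : 0 < ρ) :
    m (ball x0 ρ) = ENNReal.ofReal (c * (N + n) / N * ρ ^ N) := by
  have hp : 0 < N + n := by positivity
  set ν := weightedRadialMeasure m x0 n
  set μ : Measure ℝ := (volume.restrict (Set.Ioi 0)).withDensity
    fun r => ENNReal.ofReal (c * (N + n)) * ENNReal.ofReal (r ^ (N + n - 1)) with hμ
  have hdens : Measurable fun r : ℝ =>
      ENNReal.ofReal (c * (N + n)) * ENNReal.ofReal (r ^ (N + n - 1)) := by fun_prop
  have hIio (a : ℝ) : Set.Iio a ∩ Set.Ioi 0 = Set.Ioo 0 a := by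
    rw [Set.inter_comm, Set.Ioi_inter_Iio]
  have hνa (a : ℝ) (ha : 0 < a) : ν (Set.Iio a) = ENNReal.ofReal (c * a ^ (N + n)) := by
    have hint : IntegrableOn (fun x => dist x0 x ^ n) (ball x0 a) m := by
      refine Integrable.of_integral_ne_zero ?_
      rw [hvol a ha]
      positivity
    rw [weightedRadialMeasure_Iio, ← ofReal_integral_eq_lintegral_ofReal hint
      (Filter.Eventually.of_forall fun x => by positivity), hvol a ha]
  have hμa (a : ℝ) (ha : 0 < a) : μ (Set.Iio a) = ENNReal.ofReal (c * a ^ (N + n)) := by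
    rw [hμ, withDensity_apply _ measurableSet_Iio, Measure.restrict_restrict measurableSet_Iio,
      hIio, lintegral_const_mul _ (by fun_prop), lintegral_Ioo_rpow_sub_one hp ha.le,
      ← ENNReal.ofReal_mul (by positivity)]
    congr 1
    field_simp
  have hν0 (a : ℝ) (ha : a ≤ 0) : ν (Set.Iio a) = 0 := by
    rw [weightedRadialMeasure_Iio, ball_eq_empty.2 ha]
    simp
  have hμ0 (a : ℝ) (ha : a ≤ 0) : μ (Set.Iio a) = 0 := by
    rw [hμ, withDensity_apply _ measurableSet_Iio, Measure.restrict_restrict measurableSet_Iio,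
      hIio, Set.Ioo_eq_empty (not_lt.2 ha)]
    simp
  have heq (a : ℝ) : ν (Set.Iio a) = μ (Set.Iio a) := by
    rcases le_or_gt a 0 with ha | ha
    · rw [hν0 a ha, hμ0 a ha]
    · rw [hνa a ha, hμa a ha]
  have hrestrict : ν.restrict (Set.Iio ρ) = μ.restrict (Set.Iio ρ) := by
    have : IsFiniteMeasure (ν.restrict (Set.Iio ρ)) :=
      ⟨by rw [Measure.restrict_apply_univ, hνa ρ hρ]; exact ENNReal.ofReal_lt_top⟩
    refine ext_of_generate_finite _ (borel_eq_generateFrom_Iio ℝ ▸ BorelSpace.measurable_eq)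
      isPiSystem_Iio ?_ ?_
    · rintro _ ⟨a, rfl⟩
      rw [Measure.restrict_apply measurableSet_Iio, Measure.restrict_apply measurableSet_Iio,
        Set.Iio_inter_Iio, heq]
    · rw [Measure.restrict_apply_univ, Measure.restrict_apply_univ, heq]
  have hinv : Measurable fun r : ℝ => ENNReal.ofReal ((r ^ n)⁻¹) := by fun_prop
  rw [← setLIntegral_weightedRadialMeasure_inv m x0 hx0 n ρ, hrestrict, hμ,
    setLIntegral_withDensity_eq_setLIntegral_mul _ hdens hinv measurableSet_Iio,
    Measure.restrict_restrict measurableSet_Iio, hIio]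
  calc _ = ∫⁻ r in Set.Ioo 0 ρ,
        ENNReal.ofReal (c * (N + n)) * ENNReal.ofReal (r ^ (N - 1)) := by
        refine setLIntegral_congr_fun measurableSet_Ioo fun r hr => ?_
        have hr0 : 0 < r := hr.1
        simp only [Pi.mul_apply]
        rw [mul_assoc, ← ENNReal.ofReal_mul (by positivity),
          show N + n - 1 = N - 1 + n by ring, Real.rpow_add hr0, Real.rpow_natCast,
          mul_assoc, mul_inv_cancel₀ (by positivity), mul_one]
    _ = _ := by
        rw [lintegral_const_mul _ (by fun_prop), lintegral_Ioo_rpow_sub_one hN hρ.le,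
          ← ENNReal.ofReal_mul (by positivity)]
        congr 1
        ring

theorem stmt_16 {X : Type*} [MetricSpace X] [CompleteSpace X]
    [TopologicalSpace.SeparableSpace X] [MeasurableSpace X] [BorelSpace X]
    (m : Measure X)
    (hm : ∀ U : Set X, IsOpen U → U.Nonempty → Bornology.IsBounded U → 0 < m U ∧ m U < ⊤)
    (x0 : X) (hx0 : m {x0} = 0) (N c : ℝ) (hN : 0 < N) (hc : 0 < c)
    (k : ℕ) (hk : 1 ≤ k)
    (hvol : ∀ ρ : ℝ, 0 < ρ →
      (∫ x in ball x0 ρ, dist x0 x ^ (2 * k) ∂m) = c * ρ ^ (N + 2 * k)) :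
    (∀ ρ : ℝ, 0 < ρ → (m (ball x0 ρ)).toReal = c * (N + 2 * k) / N * ρ ^ N) ∧
    (∀ r R : ℝ, 0 < r → r < R →
      (m (ball x0 R)).toReal / (m (ball x0 r)).toReal = (R / r) ^ N) := by
  have hball (ρ : ℝ) (hρ : 0 < ρ) :
      (m (ball x0 ρ)).toReal = c * (N + 2 * k) / N * ρ ^ N := by
    rw [measure_ball_of_setIntegral_dist_pow m x0 hx0 hN hc (2 * k)
      (by exact_mod_cast hvol) hρ, ENNReal.toReal_ofReal (by positivity)]
    push_cast
    rfl
  refine ⟨hball, fun r R hr hrR => ?_⟩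
  have hR : 0 < R := hr.trans hrR
  rw [hball r hr, hball R hR, Real.div_rpow hR.le hr.le, mul_div_mul_left]
  positivity
end

section
/- Let n ≥ 1 be an integer, M > 0, and consider the metric measure space (ℝⁿ, |·|, m) where m = 𝓛ⁿ + M δ₀ is the sum of the n-dimensional Lebesgue measure and M times the Dirac mass at the origin. Then for every integer k ≥ 1 and every Lipschitz function u : ℝⁿ → ℝ with bounded support, (∫_{ℝⁿ} |x|^{2k} (lip u(x))² dm)(∫_{ℝⁿ} |x|^{2k+2} u(x)² dm) ≥ (n/2 + k)² (∫_{ℝⁿ} |x|^{2k} u(x)² dm)². -/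
open MeasureTheory Filter
open scoped ENNReal Topology NNReal

/-- The local Lipschitz constant `lip u (x) = limsup_{y → x} |u y - u x| / d(y,x)`. -/
noncomputable def lip {X : Type*} [MetricSpace X] (u : X → ℝ) (x : X) : ℝ :=
  Filter.limsup (fun y => |u y - u x| / dist y x) (𝓝[≠] x)

/-- Where `u` is differentiable, the local Lipschitz constant is the norm of the derivative. -/
theorem lip_eq_norm_fderiv {E : Type*} [NormedAddCommGroup E] [NormedSpace ℝ E] [Nontrivial E]
    {u : E → ℝ} {x : E} (hu : DifferentiableAt ℝ u x) : lip u x = ‖fderiv ℝ u x‖ := by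
  set L := fderiv ℝ u x with hL
  have upper : ∀ ε : ℝ, 0 < ε → ∀ᶠ y in 𝓝[≠] x, |u y - u x| / dist y x ≤ ‖L‖ + ε := by
    intro ε hε
    have h := (hasFDerivAt_iff_isLittleO.mp hu.hasFDerivAt).def hε
    filter_upwards [h.filter_mono nhdsWithin_le_nhds, self_mem_nhdsWithin] with y hy hyx
    have hpos : 0 < dist y x := dist_pos.mpr hyx
    rw [div_le_iff₀ hpos, dist_eq_norm]
    have h1 : |L (y - x)| ≤ ‖L‖ * ‖y - x‖ := L.le_opNorm _
    rw [Real.norm_eq_abs] at hy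
    have h2 := abs_sub_abs_le_abs_sub (u y - u x) (L (y - x))
    linarith
  have hbdd : IsBoundedUnder (· ≤ ·) (𝓝[≠] x) (fun y => |u y - u x| / dist y x) :=
    ⟨‖L‖ + 1, by simpa using upper 1 one_pos⟩
  have : NeBot (𝓝[≠] x) := Module.punctured_nhds_neBot ℝ E x
  have hcobdd : IsCoboundedUnder (· ≤ ·) (𝓝[≠] x) (fun y => |u y - u x| / dist y x) :=
    IsCoboundedUnder.of_frequently_ge (a := 0)
      (Eventually.of_forall fun y => by positivity).frequently
  apply le_antisymm
  · exact le_of_forall_pos_le_add fun ε hε => limsup_le_of_le hcobdd (upper ε hε)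
  · have hlip : 0 ≤ lip u x :=
      le_limsup_of_frequently_le (Eventually.of_forall fun y => by positivity).frequently hbdd
    refine L.opNorm_le_bound hlip fun v => ?_
    rcases eq_or_ne v 0 with rfl | hv
    · simp
    have hv' : 0 < ‖v‖ := norm_pos_iff.mpr hv
    rw [← div_le_iff₀ hv']
    refine le_of_forall_lt fun c hc => ?_
    obtain ⟨d, hcd, hd⟩ := exists_between hc
    refine hcd.trans_le (le_limsup_of_frequently_le ?_ hbdd)
    have hline : HasDerivAt (fun t : ℝ => u (x + t • v)) (L v) 0 :=
      (hu.hasFDerivAt.hasLineDerivAt v)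
    have hslope := (hasDerivAt_iff_tendsto_slope_zero.mp hline).norm.div_const ‖v‖
    have hev := hslope.eventually (lt_mem_nhds hd)
    have hpath : Tendsto (fun t : ℝ => x + t • v) (𝓝[≠] 0) (𝓝[≠] x) := by
      refine tendsto_nhdsWithin_iff.mpr ⟨?_, ?_⟩
      · have : Continuous fun t : ℝ => x + t • v := by fun_prop
        simpa using (this.tendsto 0).mono_left nhdsWithin_le_nhds
      · filter_upwards [self_mem_nhdsWithin] with t ht
        simpa [hv] using ht
    refine hpath.frequently (Eventually.frequently ?_)
    filter_upwards [hev] with t ht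
    refine ht.le.trans_eq ?_
    simp [dist_eq_norm, norm_smul, div_eq_mul_inv]
    ring

theorem integrable_of_bound_on_closedBall {E : Type*} [NormedAddCommGroup E] [ProperSpace E]
    [MeasurableSpace E] [OpensMeasurableSpace E] {μ : Measure E} [IsFiniteMeasureOnCompacts μ]
    {f : E → ℝ} (hf : AEStronglyMeasurable f μ) {R C : ℝ}
    (hzero : ∀ x, R < ‖x‖ → f x = 0) (hC : ∀ x, ‖x‖ ≤ R → |f x| ≤ C) : Integrable f μ := by
  have hsupp : Function.support f ⊆ Metric.closedBall 0 R := fun x hx => by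
    by_contra h
    exact hx (hzero x (by simpa using h))
  rw [← integrableOn_iff_integrable_of_support_subset hsupp]
  refine Measure.integrableOn_of_bounded (M := C) (isCompact_closedBall 0 R).measure_lt_top.ne hf ?_
  filter_upwards [ae_restrict_mem Metric.isClosed_closedBall.measurableSet] with x hx
  exact hC x (by simpa using hx)

/-- The Euler identity `(n + 2k) ∫ |x|^{2k} u² = - ∫ |x|^{2k} 2 u (x · ∇u)`, from scaling. -/
theorem integral_norm_pow_mul_sq_eq_neg {E : Type*} [NormedAddCommGroup E] [NormedSpace ℝ E]
    [FiniteDimensional ℝ E] [MeasurableSpace E] [BorelSpace E] (μ : Measure E)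
    [μ.IsAddHaarMeasure] {u : E → ℝ} {K : ℝ≥0} (hu : LipschitzWith K u) {R : ℝ} (hR : 0 < R)
    (hzero : ∀ x, R < ‖x‖ → u x = 0) (k : ℕ) :
    Integrable (fun x => ‖x‖ ^ (2 * k) * (2 * u x * fderiv ℝ u x x)) μ ∧
    ∫ x, ‖x‖ ^ (2 * k) * (2 * u x * fderiv ℝ u x x) ∂μ =
      -((Module.finrank ℝ E + 2 * k : ℕ) : ℝ) * ∫ x, ‖x‖ ^ (2 * k) * u x ^ 2 ∂μ := by
  obtain ⟨B, hB⟩ : ∃ B, ∀ x, |u x| ≤ B := by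
    obtain ⟨B, hB⟩ := (isCompact_closedBall (0 : E) R).exists_bound_of_continuousOn
      hu.continuous.continuousOn
    refine ⟨max B 0, fun x => ?_⟩
    rcases le_or_gt ‖x‖ R with h | h
    · exact (hB x (by simpa using h)).trans (le_max_left _ _)
    · simp [hzero x h]
  have hB0 : 0 ≤ B := (abs_nonneg _).trans (hB 0)
  have hc := hu.continuous
  set F : ℝ → E → ℝ := fun t x => ‖x‖ ^ (2 * k) * u (t • x) ^ 2 with hF
  set b : E → ℝ := (Metric.closedBall (0 : E) (2 * R)).indicator
    (fun x => ‖x‖ ^ (2 * k) * (2 * B * (K * ‖x‖))) with hb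
  have hbint : Integrable b μ := by
    refine (integrable_indicator_iff Metric.isClosed_closedBall.measurableSet).mpr ?_
    exact ContinuousOn.integrableOn_compact (isCompact_closedBall _ _) (by fun_prop)
  have hmeas : ∀ᶠ t in 𝓝 (1 : ℝ), AEStronglyMeasurable (F t) μ :=
    Eventually.of_forall fun t =>
      (by fun_prop : Continuous (F t)).aestronglyMeasurable
  have hint : Integrable (F 1) μ := by
    refine integrable_of_bound_on_closedBall (R := R) (C := R ^ (2 * k) * B ^ 2)
      hmeas.self_of_nhds (fun x hx => by simp [hF, hzero x hx]) fun x hx => ?_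
    simp only [hF, one_smul, abs_mul, abs_pow, abs_norm]
    gcongr
    exact hB x
  have hd := hasDerivAt_integral_of_dominated_loc_of_lip (μ := μ) (F := F) (x₀ := (1 : ℝ))
    (F' := fun x => ‖x‖ ^ (2 * k) * (2 * u x * fderiv ℝ u x x)) (bound := b)
    (s := Metric.ball 1 (1 / 2)) (Metric.ball_mem_nhds _ (by norm_num)) hmeas hint
    (by
      have h1 : Measurable fun x => fderiv ℝ u x x := by
        have h := measurable_fderiv ℝ u
        have happ : Continuous fun p : (E →L[ℝ] ℝ) × E => p.1 p.2 := by fun_prop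
        exact happ.measurable.comp (h.prodMk measurable_id)
      have h2 : Measurable u := hc.measurable
      exact (((measurable_norm.pow_const _).mul
        ((h2.const_mul 2).mul h1))).aestronglyMeasurable)
    (by
      refine Eventually.of_forall fun x => LipschitzOnWith.of_dist_le_mul fun s hs t ht => ?_
      have far : ∀ r ∈ Metric.ball (1 : ℝ) (1 / 2), 2 * R < ‖x‖ → u (r • x) = 0 := by
        intro r hr hx
        apply hzero
        rw [Metric.mem_ball, Real.dist_eq, abs_lt] at hr
        rw [norm_smul, Real.norm_eq_abs, abs_of_pos (by linarith [hr.1])]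
        nlinarith [hr.1]
      rcases le_or_gt ‖x‖ (2 * R) with h | h
      · have hbx : b x = ‖x‖ ^ (2 * k) * (2 * B * (K * ‖x‖)) :=
          Set.indicator_of_mem (by simpa using h) _
        have h1 : |u (s • x) - u (t • x)| ≤ K * (|s - t| * ‖x‖) := by
          have := hu.dist_le_mul (s • x) (t • x)
          rwa [Real.dist_eq, dist_eq_norm, ← sub_smul, norm_smul, Real.norm_eq_abs] at this
        have h2 : |u (s • x) + u (t • x)| ≤ 2 * B := by
          linarith [abs_add_le (u (s • x)) (u (t • x)), hB (s • x), hB (t • x)]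
        rw [Real.coe_nnabs, hbx, abs_of_nonneg (by positivity), Real.dist_eq, Real.dist_eq]
        have : F s x - F t x =
            ‖x‖ ^ (2 * k) * ((u (s • x) + u (t • x)) * (u (s • x) - u (t • x))) := by
          simp only [hF]; ring
        rw [this, abs_mul, abs_mul, abs_of_nonneg (by positivity : 0 ≤ ‖x‖ ^ (2 * k))]
        calc ‖x‖ ^ (2 * k) * (|u (s • x) + u (t • x)| * |u (s • x) - u (t • x)|)
            ≤ ‖x‖ ^ (2 * k) * (2 * B * (K * (|s - t| * ‖x‖))) := by gcongr
          _ = _ := by ring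
      · have : dist (F s x) (F t x) = 0 := by simp [hF, far s hs h, far t ht h]
        rw [this]
        positivity)
    hbint
    (by
      filter_upwards [hu.ae_differentiableAt (μ := μ)] with x hx
      have h1 : HasDerivAt (fun t : ℝ => t • x) x 1 := by
        simpa using (hasDerivAt_id (1 : ℝ)).smul_const x
      have h2 : HasDerivAt (fun t : ℝ => u (t • x)) (fderiv ℝ u x x) 1 := by
        refine HasFDerivAt.comp_hasDerivAt (x := (1 : ℝ)) (f := fun t : ℝ => t • x) ?_ h1
        simpa using hx.hasFDerivAt
      simpa [hF] using (h2.pow 2).const_mul (‖x‖ ^ (2 * k)))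
  refine ⟨hd.1, ?_⟩
  set N := Module.finrank ℝ E + 2 * k with hN
  set I := ∫ x, ‖x‖ ^ (2 * k) * u x ^ 2 ∂μ with hI
  have hscale : (fun t : ℝ => ∫ x, F t x ∂μ) =ᶠ[𝓝 1] fun t => (t ^ N)⁻¹ * I := by
    filter_upwards [lt_mem_nhds (zero_lt_one' ℝ)] with t ht
    have h1 := Measure.integral_comp_smul μ (fun x : E => ‖x‖ ^ (2 * k) * u x ^ 2) t
    have h2 : ∀ x, F t x = (t ^ (2 * k))⁻¹ * (‖t • x‖ ^ (2 * k) * u (t • x) ^ 2) := by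
      intro x
      have : t ^ (2 * k) ≠ 0 := by positivity
      simp only [hF, norm_smul, Real.norm_eq_abs, abs_of_pos ht, mul_pow]
      field_simp
    simp only [h2]
    rw [integral_const_mul, h1, abs_of_pos (by positivity), smul_eq_mul, ← mul_assoc, hN,
      pow_add, mul_inv, mul_comm (t ^ (2 * k))⁻¹]
  have hpow : HasDerivAt (fun t : ℝ => (t ^ N)⁻¹ * I) (-(N : ℝ) * I) 1 := by
    simpa using ((hasDerivAt_pow N (1 : ℝ)).fun_inv (by simp)).mul_const I
  exact hd.2.unique (hpow.congr_of_eventuallyEq hscale)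

theorem integral_add_smul_dirac_of_eq_zero {X : Type*} [MeasurableSpace X]
    [MeasurableSingletonClass X] {μ : Measure X} {f : X → ℝ} {a : X} (hf : Integrable f μ)
    (ha : f a = 0) {c : ℝ≥0∞} (hc : c ≠ ∞) :
    ∫ x, f x ∂(μ + c • Measure.dirac a) = ∫ x, f x ∂μ := by
  rw [integral_add_measure hf ((integrable_dirac (by simp)).smul_measure hc)]
  simp [ha]

theorem stmt_17 (n : ℕ) (hn : 1 ≤ n) (M : ℝ) (hM : 0 < M)
    (m : Measure (EuclideanSpace ℝ (Fin n)))
    (hm : m = volume + ENNReal.ofReal M • Measure.dirac (0 : EuclideanSpace ℝ (Fin n))) :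
    ∀ k : ℕ, 1 ≤ k → ∀ u : EuclideanSpace ℝ (Fin n) → ℝ,
      (∃ K : ℝ≥0, LipschitzWith K u) → Bornology.IsBounded (Function.support u) →
      (∫ x, ‖x‖ ^ (2 * k) * (lip u x) ^ 2 ∂m) *
        (∫ x, ‖x‖ ^ (2 * k + 2) * (u x) ^ 2 ∂m) ≥
      ((n : ℝ) / 2 + k) ^ 2 * (∫ x, ‖x‖ ^ (2 * k) * (u x) ^ 2 ∂m) ^ 2 := by
  intro k hk u ⟨K, hu⟩ hsupp
  subst hm
  have : Nontrivial (EuclideanSpace ℝ (Fin n)) :=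
    Module.nontrivial_of_finrank_pos (R := ℝ) (by simp; omega)
  obtain ⟨R, hR, hsub⟩ := hsupp.subset_closedBall_lt 0 0
  have hzero : ∀ x, R < ‖x‖ → u x = 0 := fun x hx => by
    by_contra h
    have := hsub h
    simp at this
    linarith
  have hfzero : ∀ x, R < ‖x‖ → fderiv ℝ u x = 0 := fun x hx => by
    have : u =ᶠ[𝓝 x] fun _ => 0 := by
      filter_upwards [continuous_norm.continuousAt.eventually (lt_mem_nhds hx)] with y hy
      exact hzero y hy
    rw [this.fderiv_eq]
    simp
  have hc := hu.continuous
  have hcont : ∀ j : ℕ, Integrable (fun x => ‖x‖ ^ j * u x ^ 2)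
      (volume : Measure (EuclideanSpace ℝ (Fin n))) := by
    intro j
    refine Continuous.integrable_of_hasCompactSupport (by fun_prop)
      (HasCompactSupport.of_support_subset_isCompact (isCompact_closedBall 0 R) fun x hx => ?_)
    refine hsub fun h => hx ?_
    simp [h]
  have hgrad : Integrable (fun x => ‖x‖ ^ (2 * k) * ‖fderiv ℝ u x‖ ^ 2)
      (volume : Measure (EuclideanSpace ℝ (Fin n))) := by
    refine integrable_of_bound_on_closedBall (R := R) (C := R ^ (2 * k) * K ^ 2)
      ((measurable_norm.pow_const _).mul
        ((measurable_fderiv ℝ u).norm.pow_const _)).aestronglyMeasurable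
      (fun x hx => by simp [hfzero x hx]) fun x hx => ?_
    simp only [abs_mul, abs_pow, abs_norm]
    gcongr
    exact norm_fderiv_le_of_lipschitz ℝ hu
  have hae : (fun x => ‖x‖ ^ (2 * k) * ‖fderiv ℝ u x‖ ^ 2) =ᵐ[volume]
      fun x => ‖x‖ ^ (2 * k) * (lip u x) ^ 2 := by
    filter_upwards [hu.ae_differentiableAt] with x hx
    rw [lip_eq_norm_fderiv hx]
  have hk0 : 2 * k ≠ 0 := by omega
  rw [integral_add_smul_dirac_of_eq_zero (hgrad.congr hae) (by simp [hk0]) ENNReal.ofReal_ne_top,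
    integral_add_smul_dirac_of_eq_zero (hcont _) (by simp) ENNReal.ofReal_ne_top,
    integral_add_smul_dirac_of_eq_zero (hcont _) (by simp [hk0]) ENNReal.ofReal_ne_top,
    ← integral_congr_ae hae]
  obtain ⟨hcross, heuler⟩ := integral_norm_pow_mul_sq_eq_neg
    (volume : Measure (EuclideanSpace ℝ (Fin n))) hu hR hzero k
  set P := ∫ x, ‖x‖ ^ (2 * k) * ‖fderiv ℝ u x‖ ^ 2
  set Q := ∫ x, ‖x‖ ^ (2 * k + 2) * u x ^ 2
  set I := ∫ x, ‖x‖ ^ (2 * k) * u x ^ 2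
  set D := ∫ x, ‖x‖ ^ (2 * k) * (2 * u x * fderiv ℝ u x x)
  have hquad : ∀ s : ℝ, 0 ≤ P * (s * s) + D * s + Q := by
    intro s
    have hsum : P * (s * s) + D * s + Q = ∫ x, (‖x‖ ^ (2 * k) * ‖fderiv ℝ u x‖ ^ 2 * (s * s) +
        ‖x‖ ^ (2 * k) * (2 * u x * fderiv ℝ u x x) * s + ‖x‖ ^ (2 * k + 2) * u x ^ 2) := by
      rw [integral_add (by exact (hgrad.mul_const _).add (hcross.mul_const _)) (hcont _),
        integral_add (hgrad.mul_const _) (hcross.mul_const _), integral_mul_const,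
        integral_mul_const]
    rw [hsum]
    refine integral_nonneg fun x => ?_
    have h1 : (fderiv ℝ u x x) ^ 2 ≤ (‖fderiv ℝ u x‖ * ‖x‖) ^ 2 := by
      rw [← sq_abs]
      gcongr
      exact (fderiv ℝ u x).le_opNorm x
    have h2 : 0 ≤ ‖fderiv ℝ u x‖ ^ 2 * (s * s) + 2 * u x * fderiv ℝ u x x * s
        + ‖x‖ ^ 2 * u x ^ 2 := by
      rcases eq_or_ne x 0 with rfl | hx
      · simp only [map_zero, norm_zero]
        nlinarith [mul_nonneg (sq_nonneg ‖fderiv ℝ u 0‖) (mul_self_nonneg s)]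
      · have hx' : 0 < ‖x‖ ^ 2 := by positivity
        refine nonneg_of_mul_nonneg_right ?_ hx'
        nlinarith [sq_nonneg (fderiv ℝ u x x * s + ‖x‖ ^ 2 * u x),
          mul_le_mul_of_nonneg_right h1 (mul_self_nonneg s)]
    have h3 : 0 ≤ ‖x‖ ^ (2 * k) := by positivity
    have := mul_nonneg h3 h2
    simp only [Pi.zero_apply]
    convert this using 1
    ring
  have hdisc := discrim_le_zero hquad
  rw [discrim, heuler, finrank_euclideanSpace_fin] at hdisc
  push_cast at hdisc
  nlinarith
end

section
/- Let n ≥ 1 be an integer, M > 0, and consider the metric measure space (ℝⁿ, |·|, m) where m = 𝓛ⁿ + M δ₀ is the sum of the n-dimensional Lebesgue measure and M times the Dirac mass at the origin. Then for every constant C > 0 there exists a Lipschitz function u : ℝⁿ → ℝ with bounded support such that (∫_{ℝⁿ} (lip u(x))² dm)(∫_{ℝⁿ} |x|² u(x)² dm) < C² (∫_{ℝⁿ} u(x)² dm)². That is, the L²-CKN inequality with k = 0 fails on this space for every constant C > 0. -/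
open MeasureTheory Filter
open scoped ENNReal Topology NNReal

section Lip

variable {X : Type*} [MetricSpace X] {u : X → ℝ} {x : X}

lemma lip_nonneg [(𝓝[≠] x).NeBot] {K : ℝ≥0} (hu : LipschitzWith K u) : 0 ≤ lip u x := by
  refine le_limsup_of_frequently_le (Frequently.of_forall fun y => by positivity) ?_
  refine isBoundedUnder_of ⟨K, fun y => ?_⟩
  exact div_le_of_le_mul₀ dist_nonneg K.2 (hu.dist_le_mul y x)

lemma lip_le [(𝓝[≠] x).NeBot] {K : ℝ≥0} (hu : LipschitzWith K u) : lip u x ≤ K := by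
  refine limsup_le_of_le ?_ (Eventually.of_forall fun y => ?_)
  · exact (isBoundedUnder_of ⟨0, fun y => by positivity⟩ :
      IsBoundedUnder (· ≥ ·) (𝓝[≠] x) fun y => |u y - u x| / dist y x).isCoboundedUnder_le
  · exact div_le_of_le_mul₀ dist_nonneg K.2 (hu.dist_le_mul y x)

lemma lip_eq_zero [(𝓝[≠] x).NeBot] (h : u =ᶠ[𝓝 x] 0) : lip u x = 0 := by
  have : (fun y => |u y - u x| / dist y x) =ᶠ[𝓝[≠] x] fun _ => (0 : ℝ) := by
    filter_upwards [nhdsWithin_le_nhds h] with y hy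
    simp [hy, h.eq_of_nhds]
  rw [lip, limsup_congr this, limsup_const]

end Lip

/-- The tent function of radius `r` with value one at the origin. -/
noncomputable def tent {E : Type*} [NormedAddCommGroup E] (r : ℝ) (x : E) : ℝ :=
  max 0 (1 - r⁻¹ * ‖x‖)

section Tent

variable {E : Type*} [NormedAddCommGroup E] {r : ℝ}

lemma tent_nonneg (x : E) : 0 ≤ tent r x := le_max_left _ _

lemma tent_le_one (hr : 0 < r) (x : E) : tent r x ≤ 1 := by
  have : 0 ≤ r⁻¹ * ‖x‖ := by positivity
  exact max_le zero_le_one (by linarith)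

lemma tent_zero : tent r (0 : E) = 1 := by simp [tent]

lemma tent_eq_zero (hr : 0 < r) {x : E} (hx : r ≤ ‖x‖) : tent r x = 0 := by
  have : r⁻¹ * r ≤ r⁻¹ * ‖x‖ := by gcongr
  rw [inv_mul_cancel₀ hr.ne'] at this
  exact max_eq_left (by linarith)

lemma lipschitzWith_tent (hr : 0 < r) :
    LipschitzWith (Real.toNNReal r⁻¹) (tent r : E → ℝ) := by
  refine LipschitzWith.const_max (LipschitzWith.of_dist_le_mul fun x y => ?_) 0
  rw [Real.coe_toNNReal _ (inv_nonneg.2 hr.le), Real.dist_eq,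
    show 1 - r⁻¹ * ‖x‖ - (1 - r⁻¹ * ‖y‖) = r⁻¹ * (‖y‖ - ‖x‖) by ring, abs_mul,
    abs_of_pos (inv_pos.2 hr), dist_comm, dist_eq_norm]
  gcongr
  exact abs_norm_sub_norm_le y x

lemma lip_tent_sq_le [NormedSpace ℝ E] [Nontrivial E] (hr : 0 < r) (x : E) :
    lip (tent r) x ^ 2 ≤ (Metric.closedBall (0 : E) r).indicator (fun _ => r⁻¹ ^ 2) x := by
  have : (𝓝[≠] x).NeBot := Module.punctured_nhds_neBot ℝ E x
  by_cases hx : x ∈ Metric.closedBall (0 : E) r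
  · rw [Set.indicator_of_mem hx]
    have h := lip_le (x := x) (lipschitzWith_tent (E := E) hr)
    rw [Real.coe_toNNReal _ (inv_nonneg.2 hr.le)] at h
    exact pow_le_pow_left₀ (lip_nonneg (lipschitzWith_tent hr)) h 2
  · rw [Set.indicator_of_notMem hx, lip_eq_zero, zero_pow two_ne_zero]
    filter_upwards [Metric.isClosed_closedBall.isOpen_compl.mem_nhds hx] with y hy
    refine tent_eq_zero hr ?_
    simp only [Set.mem_compl_iff, mem_closedBall_zero_iff, not_le] at hy
    exact hy.le

lemma tent_sq_le (hr : 0 < r) (x : E) :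
    tent r x ^ 2 ≤ (Metric.closedBall (0 : E) r).indicator (fun _ => 1) x := by
  by_cases hx : x ∈ Metric.closedBall (0 : E) r
  · rw [Set.indicator_of_mem hx]
    exact pow_le_one₀ (tent_nonneg x) (tent_le_one hr x)
  · rw [Set.indicator_of_notMem hx, tent_eq_zero hr (by simpa using (not_le.1 fun h => hx
      (mem_closedBall_zero_iff.2 h)).le), zero_pow two_ne_zero]

lemma norm_sq_mul_tent_sq_le (hr : 0 < r) (x : E) :
    ‖x‖ ^ 2 * tent r x ^ 2 ≤
      (Metric.closedBall (0 : E) r \ {0}).indicator (fun _ => r ^ 2) x := by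
  by_cases hx : x ∈ Metric.closedBall (0 : E) r \ {0}
  · rw [Set.indicator_of_mem hx, ← mul_one (r ^ 2)]
    have h := mem_closedBall_zero_iff.1 hx.1
    have h' := pow_le_one₀ (n := 2) (tent_nonneg x) (tent_le_one hr x)
    gcongr
  · rw [Set.indicator_of_notMem hx]
    rcases eq_or_ne x 0 with rfl | h0
    · simp
    · rw [tent_eq_zero hr (not_lt.1 fun h => hx ⟨mem_closedBall_zero_iff.2 h.le, h0⟩)]
      simp

end Tent

theorem stmt_18 (n : ℕ) (hn : 1 ≤ n) (M : ℝ) (hM : 0 < M)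
    (m : Measure (EuclideanSpace ℝ (Fin n)))
    (hm : m = volume + ENNReal.ofReal M • Measure.dirac (0 : EuclideanSpace ℝ (Fin n))) :
    ∀ C : ℝ, 0 < C → ∃ u : EuclideanSpace ℝ (Fin n) → ℝ,
      (∃ K : ℝ≥0, LipschitzWith K u) ∧ Bornology.IsBounded (Function.support u) ∧
      (∫ x, (lip u x) ^ 2 ∂m) * (∫ x, ‖x‖ ^ 2 * (u x) ^ 2 ∂m) <
        C ^ 2 * (∫ x, (u x) ^ 2 ∂m) ^ 2 := by
  intro C hC
  have : Nonempty (Fin n) := ⟨⟨0, hn⟩⟩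
  set E := EuclideanSpace ℝ (Fin n)
  obtain ⟨r, hr, hsmall⟩ : ∃ r : ℝ, 0 < r ∧
      ((volume.real (Metric.closedBall (0 : E) r) + M) *
        volume.real (Metric.closedBall (0 : E) r)) < C ^ 2 * M ^ 2 := by
    have hcont : Continuous fun r : ℝ => (r ^ n * volume.real (Metric.ball (0 : E) 1) + M) *
        (r ^ n * volume.real (Metric.ball (0 : E) 1)) := by fun_prop
    have hev := hcont.continuousAt.eventually_lt (continuousAt_const (x := (0 : ℝ))
      (y := C ^ 2 * M ^ 2)) (by
        rw [zero_pow (by omega)]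
        simp only [zero_mul, mul_zero]
        positivity)
    obtain ⟨r, hlt, hr⟩ := ((hev.filter_mono nhdsWithin_le_nhds).and
      (self_mem_nhdsWithin (s := Set.Ioi (0 : ℝ)))).exists
    refine ⟨r, hr, ?_⟩
    rw [Measure.addHaar_real_closedBall _ _ (le_of_lt hr)]
    simpa [E] using hlt
  set v := volume.real (Metric.closedBall (0 : E) r)
  have hv : 0 ≤ v := measureReal_nonneg
  have hfin : volume (Metric.closedBall (0 : E) r) ≠ ∞ := measure_closedBall_lt_top.ne
  have hmB : m (Metric.closedBall (0 : E) r) =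
      volume (Metric.closedBall (0 : E) r) + ENNReal.ofReal M := by
    simp [hm, hr.le]
  have hmB_fin : m (Metric.closedBall (0 : E) r) ≠ ∞ := by
    simp [hmB, hfin]
  have hmB_real : m.real (Metric.closedBall (0 : E) r) = v + M := by
    rw [measureReal_def, hmB, ENNReal.toReal_add hfin ENNReal.ofReal_ne_top,
      ENNReal.toReal_ofReal hM.le, ← measureReal_def]
  have hmD : m (Metric.closedBall (0 : E) r \ {0}) ≤ volume (Metric.closedBall (0 : E) r) := by
    have hms : MeasurableSet (Metric.closedBall (0 : E) r \ {0}) := by measurability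
    simp [hm, Measure.dirac_apply' _ hms, measure_mono Set.sdiff_subset]
  have hmD_real : m.real (Metric.closedBall (0 : E) r \ {0}) ≤ v :=
    ENNReal.toReal_mono hfin hmD
  have hm0 : M = m.real {(0 : E)} := by
    simp [hm, measureReal_def, hM.le]
  have hB_meas : MeasurableSet (Metric.closedBall (0 : E) r) := measurableSet_closedBall
  have hD_meas : MeasurableSet (Metric.closedBall (0 : E) r \ {0}) :=
    hB_meas.diff (measurableSet_singleton 0)
  have hB_int (c : ℝ) : Integrable ((Metric.closedBall (0 : E) r).indicator fun _ => c) m :=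
    (integrable_indicator_iff hB_meas).2 (integrableOn_const hmB_fin)
  have hlip := lipschitzWith_tent (E := E) hr
  have hgrad : ∫ x, lip (tent r) x ^ 2 ∂m ≤ (v + M) * r⁻¹ ^ 2 := by
    refine (integral_mono_of_nonneg (Eventually.of_forall fun x => sq_nonneg _)
      (hB_int (r⁻¹ ^ 2)) (Eventually.of_forall (lip_tent_sq_le hr))).trans_eq ?_
    rw [integral_indicator_const _ hB_meas, hmB_real, smul_eq_mul]
  have hmoment : ∫ x, ‖x‖ ^ 2 * tent r x ^ 2 ∂m ≤ v * r ^ 2 := by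
    refine (integral_mono_of_nonneg (Eventually.of_forall fun x => by positivity)
      ((integrable_indicator_iff hD_meas).2
        (integrableOn_const (ne_top_of_le_ne_top hfin hmD)))
      (Eventually.of_forall (norm_sq_mul_tent_sq_le hr))).trans ?_
    rw [integral_indicator_const _ hD_meas, smul_eq_mul]
    gcongr
  have hmass : M ≤ ∫ x, tent r x ^ 2 ∂m := by
    have hint : Integrable (fun x : E => tent r x ^ 2) m :=
      (hB_int 1).mono' (hlip.continuous.pow 2).aestronglyMeasurable
        (Eventually.of_forall fun x => by
          rw [Real.norm_of_nonneg (sq_nonneg _)]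
          exact tent_sq_le hr x)
    calc M = ∫ x, ({(0 : E)} : Set E).indicator (fun _ => (1 : ℝ)) x ∂m := by
          rw [integral_indicator_const _ (measurableSet_singleton 0), ← hm0]
          simp
      _ ≤ _ := by
          refine integral_mono_of_nonneg (Eventually.of_forall fun x =>
            Set.indicator_nonneg (fun _ _ => zero_le_one) x) hint
            (Eventually.of_forall fun x => ?_)
          refine Set.indicator_le' (fun y hy => ?_) (fun y _ => sq_nonneg _) x
          rw [Set.mem_singleton_iff.1 hy, tent_zero, one_pow]
  refine ⟨tent r, ⟨_, hlip⟩, ?_, ?_⟩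
  · refine (Metric.isBounded_closedBall (x := (0 : E)) (r := r)).subset fun x hx => ?_
    exact mem_closedBall_zero_iff.2 (not_lt.1 fun h => hx (tent_eq_zero hr h.le))
  · calc _ ≤ ((v + M) * r⁻¹ ^ 2) * (v * r ^ 2) :=
          mul_le_mul hgrad hmoment (integral_nonneg fun x => by positivity) (by positivity)
      _ = (v + M) * v := by field_simp
      _ < C ^ 2 * M ^ 2 := hsmall
      _ ≤ _ := by gcongr
end
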